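/- Let stat be a Z-statistic. Then for all integers n ≥ 1 and k ≥ 2, Σ_{π ∈ Π_n^k} stat(π) = Σ_{m=0}^{n} C(n,m)·S_{n−m,k−2}·v_m, where v_m = Σ_{π ∈ Π_m^2} stat(π) and C(n,m) is a binomial coefficient. Consequently, summing over k, Σ_{π ∈ Π_n} stat(π) = Σ_{m=0}^{n} C(n,m)·B_{n−m}·v_m. -/

import Mathlib

open scoped Classical

def seg (n : ℕ) : Finset ℕ := Finset.Icc 1 n

def IsPartition (P : Finset (Finset ℕ)) (S : Finset ℕ) : Prop :=
  ∅ ∉ P ∧ (∀ B ∈ P, ∀ C ∈ P, B ≠ C → Disjoint B C) ∧ P.biUnion id = S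

noncomputable def partitions (n : ℕ) : Finset (Finset (Finset ℕ)) :=
  ((seg n).powerset.powerset).filter fun P => IsPartition P (seg n)

noncomputable def partitionsK (n k : ℕ) : Finset (Finset (Finset ℕ)) :=
  (partitions n).filter fun P => P.card = k

noncomputable def bell (n : ℕ) : ℕ := (partitions n).card

noncomputable def stirling (n k : ℕ) : ℕ := (partitionsK n k).card

/-- `(i, j)` is an edge of the set partition `P`. -/
def IsEdge (P : Finset (Finset ℕ)) (i j : ℕ) : Prop :=
  i < j ∧ ∃ B ∈ P, i ∈ B ∧ j ∈ B ∧ ∀ p ∈ B, ¬(i < p ∧ p < j)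

/-- `crol P`: number of linear crossings. -/
noncomputable def crol (P : Finset (Finset ℕ)) : ℕ :=
  Nat.card {e : (ℕ × ℕ) × ℕ × ℕ //
    IsEdge P e.1.1 e.1.2 ∧ IsEdge P e.2.1 e.2.2 ∧
      e.1.1 < e.2.1 ∧ e.2.1 < e.1.2 ∧ e.1.2 < e.2.2}

/-- `(i, j)` is a circular edge of `P`. -/
def IsCircEdge (P : Finset (Finset ℕ)) (i j : ℕ) : Prop :=
  IsEdge P i j ∨
    ∃ B ∈ P, ∃ h : B.Nonempty, 2 ≤ B.card ∧ i = B.min' h ∧ j = B.max' h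

/-- `croc P`: number of circular crossings. -/
noncomputable def croc (P : Finset (Finset ℕ)) : ℕ :=
  Nat.card {e : (ℕ × ℕ) × ℕ × ℕ //
    IsCircEdge P e.1.1 e.1.2 ∧ IsCircEdge P e.2.1 e.2.2 ∧
      e.1.1 < e.2.1 ∧ e.2.1 < e.1.2 ∧ e.1.2 < e.2.2}

/-- Two blocks overlap: `min B < min B' < max B < max B'`. -/
def Overlap (B B' : Finset ℕ) : Prop :=
  ∃ (h : B.Nonempty) (h' : B'.Nonempty),
    B.min' h < B'.min' h' ∧ B'.min' h' < B.max' h ∧ B.max' h < B'.max' h'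

/-- `ov P`: number of (unordered) pairs of blocks of `P` that overlap. -/
noncomputable def ov (P : Finset (Finset ℕ)) : ℕ :=
  Nat.card {p : Finset ℕ × Finset ℕ // p.1 ∈ P ∧ p.2 ∈ P ∧ Overlap p.1 p.2}

/-- Two blocks embrace: `min B < min B' ≤ max B' < max B`. -/
def Embrace (B B' : Finset ℕ) : Prop :=
  ∃ (h : B.Nonempty) (h' : B'.Nonempty),
    B.min' h < B'.min' h' ∧ B'.min' h' ≤ B'.max' h' ∧ B'.max' h' < B.max' h

noncomputable def emb (P : Finset (Finset ℕ)) : ℕ :=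
  Nat.card {p : Finset ℕ × Finset ℕ // p.1 ∈ P ∧ p.2 ∈ P ∧ Embrace p.1 p.2}

/-- The block of `P` containing `i`. -/
noncomputable def blockOf (P : Finset (Finset ℕ)) (i : ℕ) : Finset ℕ :=
  (P.filter fun B => i ∈ B).biUnion id

/-- The restricted growth function of `P`: `rgf P i = j` iff `i` lies in the `j`-th
block of `P`, the blocks being ordered by increasing minima. -/
noncomputable def rgf (P : Finset (Finset ℕ)) (i : ℕ) : ℕ :=
  (P.filter fun B => B.min ≤ (blockOf P i).min).card

/-- A 2-pattern: a word on `{1,2}` containing both letters. -/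
def TwoPattern {r : ℕ} (σ : Fin r → ℕ) : Prop :=
  (∀ t, σ t = 1 ∨ σ t = 2) ∧ (∃ t, σ t = 1) ∧ (∃ t, σ t = 2)

/-- `occ n σ P`: number of occurrences of the 2-pattern `σ` in the partition `P` of `[n]`. -/
noncomputable def occ (n : ℕ) {r : ℕ} (σ : Fin r → ℕ) (P : Finset (Finset ℕ)) : ℕ :=
  Nat.card {i : Fin r → ℕ // StrictMono i ∧ (∀ t, i t ∈ seg n) ∧
    ∃ a b : ℕ, a < b ∧
      ∀ t, (σ t = 1 → rgf P (i t) = a) ∧ (σ t = 2 → rgf P (i t) = b)}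

/-- Carlitz `q`-Stirling polynomials. -/
noncomputable def qS : ℕ → ℕ → Polynomial ℚ
  | 0, 0 => 1
  | 0, _ + 1 => 0
  | _ + 1, 0 => 0
  | n + 1, k + 1 =>
      Polynomial.X ^ k * qS n k +
        (∑ i ∈ Finset.range (k + 1), Polynomial.X ^ i) * qS n (k + 1)

/-- Standardization: the order preserving bijection `S → [|S|]`. -/
def stdMap (S : Finset ℕ) (a : ℕ) : ℕ := (S.filter fun x => x ≤ a).card

/-- The standardized 2-block partition obtained from two blocks `A, B`. -/
def stdPair (A B : Finset ℕ) : Finset (Finset ℕ) :=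
  {A.image (stdMap (A ∪ B)), B.image (stdMap (A ∪ B))}

/-- The partitions of a finite set whose number of blocks satisfies `c`. -/
noncomputable def partitionsWith (c : ℕ → Prop) (S : Finset ℕ) : Finset (Finset (Finset ℕ)) :=
  S.powerset.powerset.filter fun P => IsPartition P S ∧ c P.card

lemma IsPartition.subset {P : Finset (Finset ℕ)} {S B : Finset ℕ} (h : IsPartition P S)
    (hB : B ∈ P) : B ⊆ S := by
  rw [← h.2.2]
  exact Finset.subset_biUnion_of_mem id hB

lemma IsPartition.nonempty {P : Finset (Finset ℕ)} {S B : Finset ℕ} (h : IsPartition P S)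
    (hB : B ∈ P) : B.Nonempty :=
  Finset.nonempty_iff_ne_empty.2 fun h0 => h.1 (h0 ▸ hB)

lemma mem_partitionsWith {c : ℕ → Prop} {S : Finset ℕ} {P : Finset (Finset ℕ)} :
    P ∈ partitionsWith c S ↔ IsPartition P S ∧ c P.card := by
  simp only [partitionsWith, Finset.mem_filter, Finset.mem_powerset, and_iff_right_iff_imp]
  exact fun h B hB => Finset.mem_powerset.2 (h.1.subset hB)

lemma partitions_eq_partitionsWith (n : ℕ) :
    partitions n = partitionsWith (fun _ => True) (seg n) := by
  ext P
  simp [partitions, partitionsWith]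

lemma partitionsK_eq_partitionsWith (n k : ℕ) :
    partitionsK n k = partitionsWith (· = k) (seg n) := by
  ext P
  simp [partitionsK, partitions, partitionsWith, and_assoc]

lemma IsPartition.image {P : Finset (Finset ℕ)} {S : Finset ℕ} (h : IsPartition P S)
    {φ : ℕ → ℕ} (hφ : Set.InjOn φ S) :
    IsPartition (P.image (Finset.image φ)) (S.image φ) := by
  refine ⟨?_, ?_, ?_⟩
  · simpa using h.1
  · simp only [Finset.mem_image, forall_exists_index, and_imp, forall_apply_eq_imp_iff₂]
    intro B hB C hC hne
    have hd := h.2.1 B hB C hC (by rintro rfl; exact hne rfl)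
    rw [Finset.disjoint_left] at hd ⊢
    simp only [Finset.mem_image]
    rintro _ ⟨x, hx, rfl⟩ ⟨y, hy, hxy⟩
    exact hd hx (hφ (h.subset hC hy) (h.subset hB hx) hxy ▸ hy)
  · ext x
    simp only [← h.2.2, Finset.mem_biUnion, Finset.mem_image, id]
    grind

lemma image_image_eq_of_leftInvOn {S : Finset ℕ} {P : Finset (Finset ℕ)} (h : IsPartition P S)
    {φ ψ : ℕ → ℕ} (hψ : ∀ x ∈ S, ψ (φ x) = x) :
    (P.image (Finset.image φ)).image (Finset.image ψ) = P := by
  rw [Finset.image_image]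
  conv_rhs => rw [← Finset.image_id (s := P)]
  refine Finset.image_congr fun B hB => ?_
  simp only [Function.comp, Finset.image_image, id]
  conv_rhs => rw [← Finset.image_id (s := B)]
  exact Finset.image_congr fun x hx => hψ x (h.subset hB hx)

lemma card_image_image_of_leftInvOn {S : Finset ℕ} {P : Finset (Finset ℕ)}
    (h : IsPartition P S) {φ ψ : ℕ → ℕ} (hψ : ∀ x ∈ S, ψ (φ x) = x) :
    (P.image (Finset.image φ)).card = P.card := by
  refine le_antisymm Finset.card_image_le ?_
  conv_lhs => rw [← image_image_eq_of_leftInvOn h hψ]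
  exact Finset.card_image_le

/-- Sums over partitions are transported along injective maps. -/
lemma sum_partitionsWith_image (c : ℕ → Prop) (S : Finset ℕ) {φ : ℕ → ℕ} (hφ : Set.InjOn φ S)
    (F : Finset (Finset ℕ) → ℕ) :
    ∑ P ∈ partitionsWith c S, F (P.image (Finset.image φ)) =
      ∑ P ∈ partitionsWith c (S.image φ), F P := by
  set ψ := Function.invFunOn φ (S : Set ℕ)
  have hψ : ∀ x ∈ S, ψ (φ x) = x := fun x hx => hφ.leftInvOn_invFunOn hx
  have hφψ : ∀ y ∈ S.image φ, φ (ψ y) = y := by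
    simp only [Finset.mem_image]
    rintro _ ⟨x, hx, rfl⟩
    rw [hψ x hx]
  have hψ_inj : Set.InjOn ψ (S.image φ : Finset ℕ) := fun x hx y hy hxy => by
    rw [← hφψ x hx, hxy, hφψ y hy]
  have h_image : (S.image φ).image ψ = S := by
    rw [Finset.image_image]
    conv_rhs => rw [← Finset.image_id (s := S)]
    exact Finset.image_congr hψ
  refine Finset.sum_bij' (fun P _ => P.image (Finset.image φ))
    (fun P _ => P.image (Finset.image ψ)) ?_ ?_ ?_ ?_ (fun _ _ => rfl)
  · intro P hP
    rw [mem_partitionsWith] at hP ⊢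
    exact ⟨hP.1.image hφ, (card_image_image_of_leftInvOn hP.1 hψ).symm ▸ hP.2⟩
  · intro P hP
    rw [mem_partitionsWith] at hP ⊢
    refine ⟨?_, (card_image_image_of_leftInvOn hP.1 hφψ).symm ▸ hP.2⟩
    have := hP.1.image hψ_inj
    rwa [h_image] at this
  · intro P hP
    exact image_image_eq_of_leftInvOn (mem_partitionsWith.1 hP).1 hψ
  · intro P hP
    exact image_image_eq_of_leftInvOn (mem_partitionsWith.1 hP).1 hφψ

lemma stdMap_injOn (S : Finset ℕ) : Set.InjOn (stdMap S) S := by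
  have h : StrictMonoOn (stdMap S) S := fun x _ y hy hxy => by
    refine Finset.card_lt_card (Finset.ssubset_iff_subset_ne.2 ⟨fun z => ?_, fun h => ?_⟩)
    · simp only [Finset.mem_filter]
      exact fun hz => ⟨hz.1, hz.2.trans hxy.le⟩
    · have hy' : y ∈ S.filter fun z => z ≤ y := Finset.mem_filter.2 ⟨hy, le_rfl⟩
      rw [← h, Finset.mem_filter] at hy'
      omega
  exact h.injOn

lemma image_stdMap (S : Finset ℕ) : S.image (stdMap S) = seg S.card := by
  refine Finset.eq_of_subset_of_card_le (fun y hy => ?_) ?_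
  · obtain ⟨x, hx, rfl⟩ := Finset.mem_image.1 hy
    refine Finset.mem_Icc.2 ⟨Finset.card_pos.2 ⟨x, ?_⟩, Finset.card_filter_le _ _⟩
    exact Finset.mem_filter.2 ⟨hx, le_rfl⟩
  · rw [Finset.card_image_of_injOn (stdMap_injOn S)]
    simp [seg]

lemma card_partitionsWith (c : ℕ → Prop) (S : Finset ℕ) :
    (partitionsWith c S).card = (partitionsWith c (seg S.card)).card := by
  have h := sum_partitionsWith_image c S (stdMap_injOn S) fun _ => 1
  rw [image_stdMap] at h
  simpa using h

lemma sum_offDiag_stdPair {σ : Finset (Finset ℕ)} {T : Finset ℕ} (h : IsPartition σ T)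
    (hσ : σ.card = 2) (f : Finset (Finset ℕ) → ℕ) :
    ∑ p ∈ σ.offDiag, f (stdPair p.1 p.2) = 2 * f (σ.image (Finset.image (stdMap T))) := by
  have h_const : ∀ p ∈ σ.offDiag,
      f (stdPair p.1 p.2) = f (σ.image (Finset.image (stdMap T))) := by
    rintro ⟨A, B⟩ hp
    obtain ⟨hA, hB, hne⟩ := Finset.mem_offDiag.1 hp
    have h_pair : ({A, B} : Finset (Finset ℕ)) = σ := by
      refine Finset.eq_of_subset_of_card_le ?_ ?_
      · simp [Finset.insert_subset_iff, hA, hB]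
      · rw [hσ, Finset.card_pair hne]
    have hT : A ∪ B = T := by
      rw [← h.2.2, ← h_pair]
      simp
    simp [stdPair, ← h_pair, hT, Finset.image_insert]
  rw [Finset.sum_congr rfl h_const, Finset.sum_const, Finset.offDiag_card, hσ, smul_eq_mul]

lemma sum_two_blocks_offDiag_stdPair (T : Finset ℕ) (f : Finset (Finset ℕ) → ℕ) :
    ∑ σ ∈ partitionsWith (· = 2) T, ∑ p ∈ σ.offDiag, f (stdPair p.1 p.2) =
      2 * ∑ σ ∈ partitionsK T.card 2, f σ := by
  rw [partitionsK_eq_partitionsWith, ← image_stdMap T,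
    ← sum_partitionsWith_image _ T (stdMap_injOn T), Finset.mul_sum]
  refine Finset.sum_congr rfl fun σ hσ => ?_
  rw [mem_partitionsWith] at hσ
  exact sum_offDiag_stdPair hσ.1 hσ.2 f

lemma IsPartition.of_subset {P Q : Finset (Finset ℕ)} {S : Finset ℕ} (h : IsPartition P S)
    (hQ : Q ⊆ P) : IsPartition Q (Q.biUnion id) :=
  ⟨fun h0 => h.1 (hQ h0), fun B hB C hC => h.2.1 B (hQ hB) C (hQ hC), rfl⟩

lemma IsPartition.sdiff {P Q : Finset (Finset ℕ)} {S : Finset ℕ} (h : IsPartition P S)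
    (hQ : Q ⊆ P) : IsPartition (P \ Q) (S \ Q.biUnion id) := by
  have h_union : (P \ Q).biUnion id = S \ Q.biUnion id := by
    ext x
    simp only [← h.2.2, Finset.mem_biUnion, Finset.mem_sdiff, id, not_exists, not_and]
    constructor
    · rintro ⟨B, ⟨hB, hBQ⟩, hx⟩
      refine ⟨⟨B, hB, hx⟩, fun C hC hxC => ?_⟩
      exact Finset.disjoint_left.1 (h.2.1 B hB C (hQ hC) fun e => hBQ (e ▸ hC)) hx hxC
    · rintro ⟨⟨B, hB, hx⟩, hxQ⟩
      exact ⟨B, ⟨hB, fun hBQ => hxQ B hBQ hx⟩, hx⟩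
  exact h_union ▸ h.of_subset Finset.sdiff_subset

lemma IsPartition.union {P Q : Finset (Finset ℕ)} {S T : Finset ℕ} (hP : IsPartition P S)
    (hQ : IsPartition Q T) (hST : Disjoint S T) : IsPartition (P ∪ Q) (S ∪ T) := by
  refine ⟨?_, ?_, ?_⟩
  · simp [hP.1, hQ.1]
  · intro B hB C hC hne
    rcases Finset.mem_union.1 hB with hB | hB <;> rcases Finset.mem_union.1 hC with hC | hC
    · exact hP.2.1 B hB C hC hne
    · exact hST.mono (hP.subset hB) (hQ.subset hC)
    · exact hST.symm.mono (hQ.subset hB) (hP.subset hC)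
    · exact hQ.2.1 B hB C hC hne
  · rw [Finset.union_biUnion, hP.2.2, hQ.2.2]

lemma IsPartition.disjoint_blocks {P Q : Finset (Finset ℕ)} {S T : Finset ℕ}
    (hP : IsPartition P S) (hQ : IsPartition Q T) (hST : Disjoint S T) : Disjoint P Q := by
  rw [Finset.disjoint_left]
  intro B hB hB'
  obtain ⟨x, hx⟩ := hP.nonempty hB
  exact Finset.disjoint_left.1 hST (hP.subset hB hx) (hQ.subset hB' hx)

/-- Choosing a partition with an ordered pair of distinct blocks amounts to choosing the union of
these two blocks, its partition into them, and a partition of the complement. -/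
lemma sum_offDiag_partitionsWith (c : ℕ → Prop) (S : Finset ℕ)
    (g : Finset ℕ × Finset ℕ → ℕ) :
    ∑ P ∈ partitionsWith c S, ∑ p ∈ P.offDiag, g p =
      ∑ T ∈ S.powerset,
        ∑ q ∈ partitionsWith (· = 2) T ×ˢ partitionsWith (fun j => c (j + 2)) (S \ T),
          ∑ p ∈ q.1.offDiag, g p := by
  simp only [Finset.sum_sigma']
  refine Finset.sum_bij'
    (fun x _ => ⟨x.2.1 ∪ x.2.2, ({x.2.1, x.2.2}, x.1 \ {x.2.1, x.2.2}), x.2⟩)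
    (fun y _ => ⟨y.2.1.1 ∪ y.2.1.2, y.2.2⟩) ?_ ?_ ?_ ?_ (fun _ _ => rfl)
  · rintro ⟨P, A, B⟩ hx
    simp only [Finset.mem_sigma, Finset.mem_offDiag, mem_partitionsWith] at hx
    obtain ⟨⟨hP, hc⟩, hA, hB, hne⟩ := hx
    have h_sub : ({A, B} : Finset (Finset ℕ)) ⊆ P := by
      simp [Finset.insert_subset_iff, hA, hB]
    have h_union : ({A, B} : Finset (Finset ℕ)).biUnion id = A ∪ B := by simp
    have h_card : (P \ {A, B}).card + 2 = P.card := by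
      rw [← Finset.card_pair hne, Finset.card_sdiff_add_card_eq_card h_sub]
    simp only [Finset.mem_sigma, Finset.mem_product, Finset.mem_offDiag, mem_partitionsWith,
      Finset.mem_powerset, h_card]
    refine ⟨Finset.union_subset (hP.subset hA) (hP.subset hB),
      ⟨⟨?_, Finset.card_pair hne⟩, ?_, hc⟩, by simp, by simp, hne⟩
    · exact h_union ▸ hP.of_subset h_sub
    · exact h_union ▸ hP.sdiff h_sub
  · rintro ⟨T, ⟨σ, ρ⟩, A, B⟩ hy
    simp only [Finset.mem_sigma, Finset.mem_product, Finset.mem_offDiag, mem_partitionsWith,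
      Finset.mem_powerset] at hy
    obtain ⟨hT, ⟨⟨hσ, h_two⟩, hρ, hc⟩, hA, hB, hne⟩ := hy
    have h_part := hσ.union hρ Finset.disjoint_sdiff
    rw [Finset.union_sdiff_of_subset hT] at h_part
    simp only [Finset.mem_sigma, Finset.mem_offDiag, mem_partitionsWith]
    refine ⟨⟨h_part, ?_⟩, Finset.mem_union_left _ hA, Finset.mem_union_left _ hB, hne⟩
    rwa [Finset.card_union_of_disjoint (hσ.disjoint_blocks hρ Finset.disjoint_sdiff), h_two,
      add_comm]
  · rintro ⟨P, A, B⟩ hx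
    simp only [Finset.mem_sigma, Finset.mem_offDiag] at hx
    have h_sub : ({A, B} : Finset (Finset ℕ)) ⊆ P := by
      simp [Finset.insert_subset_iff, hx.2.1, hx.2.2.1]
    simp only [Finset.union_sdiff_of_subset h_sub]
  · rintro ⟨T, ⟨σ, ρ⟩, A, B⟩ hy
    simp only [Finset.mem_sigma, Finset.mem_product, Finset.mem_offDiag, mem_partitionsWith,
      Finset.mem_powerset] at hy
    obtain ⟨hT, ⟨⟨hσ, h_two⟩, hρ, hc⟩, hA, hB, hne⟩ := hy
    have h_pair : ({A, B} : Finset (Finset ℕ)) = σ := by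
      refine Finset.eq_of_subset_of_card_le ?_ ?_
      · simp [Finset.insert_subset_iff, hA, hB]
      · rw [h_two, Finset.card_pair hne]
    have h_union : A ∪ B = T := by
      rw [← hσ.2.2, ← h_pair]
      simp
    simp only [h_union, h_pair, Finset.union_sdiff_cancel_left
      (hσ.disjoint_blocks hρ Finset.disjoint_sdiff)]

/-- The convolution identity for partitions with a restricted number of blocks. -/
lemma sum_partitionsWith_convolution (stat : Finset (Finset ℕ) → ℕ)
    (hZ : ∀ (S : Finset ℕ) (P : Finset (Finset ℕ)), (∀ x ∈ S, 1 ≤ x) → IsPartition P S →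
      2 * stat P = ∑ p ∈ P.offDiag, stat (stdPair p.1 p.2)) (n : ℕ) (c : ℕ → Prop) :
    ∑ π ∈ partitionsWith c (seg n), stat π =
      ∑ m ∈ Finset.range (n + 1), n.choose m *
        (partitionsWith (fun j => c (j + 2)) (seg (n - m))).card *
          ∑ π ∈ partitionsK m 2, stat π := by
  refine Nat.eq_of_mul_eq_mul_left two_pos ?_
  have h_seg : (seg n).card = n := by simp [seg]
  calc 2 * ∑ π ∈ partitionsWith c (seg n), stat π
      = ∑ π ∈ partitionsWith c (seg n), ∑ p ∈ π.offDiag, stat (stdPair p.1 p.2) := by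
        rw [Finset.mul_sum]
        refine Finset.sum_congr rfl fun π hπ => ?_
        exact hZ (seg n) π (fun x hx => (Finset.mem_Icc.1 hx).1) (mem_partitionsWith.1 hπ).1
    _ = ∑ T ∈ (seg n).powerset,
          (partitionsWith (fun j => c (j + 2)) (seg (n - T.card))).card *
            (2 * ∑ σ ∈ partitionsK T.card 2, stat σ) := by
        rw [sum_offDiag_partitionsWith c (seg n) fun p => stat (stdPair p.1 p.2)]
        refine Finset.sum_congr rfl fun T hT => ?_
        simp only [Finset.sum_product_right]
        rw [Finset.sum_const, smul_eq_mul, sum_two_blocks_offDiag_stdPair,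
          card_partitionsWith,
          Finset.card_sdiff_of_subset (Finset.mem_powerset.1 hT), h_seg]
    _ = _ := by
        rw [Finset.sum_powerset_apply_card (fun m =>
          (partitionsWith (fun j => c (j + 2)) (seg (n - m))).card *
            (2 * ∑ σ ∈ partitionsK m 2, stat σ)), h_seg, Finset.mul_sum]
        refine Finset.sum_congr rfl fun m _ => ?_
        rw [smul_eq_mul]
        ring

/-- the key convolution identity for a Z-statistic. The Z-property is stated
in the (equivalent) ordered form: twice the statistic equals the sum over ordered pairs of
distinct blocks of the value of the statistic at the standardized 2-block partition. -/
theorem zstatistic_convolution (stat : Finset (Finset ℕ) → ℕ)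
    (hZ : ∀ (S : Finset ℕ) (P : Finset (Finset ℕ)), (∀ x ∈ S, 1 ≤ x) → IsPartition P S →
      2 * stat P = ∑ p ∈ P.offDiag, stat (stdPair p.1 p.2))
    (n : ℕ) (hn : 1 ≤ n) :
    (∀ k, 2 ≤ k →
      (∑ π ∈ partitionsK n k, stat π)
        = ∑ m ∈ Finset.range (n+1),
            n.choose m * stirling (n-m) (k-2) * (∑ π ∈ partitionsK m 2, stat π)) ∧
    (∑ π ∈ partitions n, stat π)
      = ∑ m ∈ Finset.range (n+1),
          n.choose m * bell (n-m) * (∑ π ∈ partitionsK m 2, stat π) := by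
  refine ⟨fun k hk => ?_, ?_⟩
  · obtain ⟨k, rfl⟩ := Nat.exists_eq_add_of_le' hk
    rw [partitionsK_eq_partitionsWith, sum_partitionsWith_convolution stat hZ]
    simp only [stirling, partitionsK_eq_partitionsWith, add_left_inj, Nat.add_sub_cancel]
  · rw [partitions_eq_partitionsWith, sum_partitionsWith_convolution stat hZ]
    simp only [bell, partitions_eq_partitionsWith]
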